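/- Let (V, σ) be a real symplectic vector space and μ a finitely additive probability measure on its subspace lattice with symplectic complementation. Then μ takes the same value on all symplectic planes (2-dimensional subspaces on which σ is non-degenerate). -/

import Mathlib

/-- The symplectic complement of a subspace with respect to a bilinear form. -/
def sC {V : Type*} [AddCommGroup V] [Module ℝ V] (σ : V →ₗ[ℝ] V →ₗ[ℝ] ℝ)
    (A : Submodule ℝ V) : Submodule ℝ V where
  carrier := {v | ∀ a ∈ A, σ v a = 0}
  add_mem' := by
    intro x y hx hy a ha
    simp [map_add, LinearMap.add_apply, hx a ha, hy a ha]
  zero_mem' := by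
    intro a ha
    simp
  smul_mem' := by
    intro r x hx a ha
    simp [map_smul, LinearMap.smul_apply, hx a ha]

/-- A plane meeting its symplectic complement trivially is spanned by two vectors pairing
nontrivially. -/
theorem exists_span_pair_of_symplectic_plane {V : Type*} [AddCommGroup V] [Module ℝ V]
    (σ : V →ₗ[ℝ] V →ₗ[ℝ] ℝ) (halt : ∀ v : V, σ v v = 0) (P : Submodule ℝ V)
    (hP2 : Module.finrank ℝ P = 2) (hP : P ⊓ sC σ P = ⊥) :
    ∃ a b : V, σ a b ≠ 0 ∧ P = Submodule.span ℝ {a, b} := by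
  have : Module.Finite ℝ P := Module.finite_of_finrank_eq_succ hP2
  let e := Module.finBasisOfFinrankEq ℝ P hP2
  have hspan : P = Submodule.span ℝ {(e 0 : V), (e 1 : V)} := by
    have h := congrArg (Submodule.map P.subtype) e.span_eq
    rw [Submodule.map_span, ← Set.range_comp, Submodule.map_top, Submodule.range_subtype] at h
    refine h.symm.trans (congrArg _ ?_)
    ext v
    simp [Fin.exists_fin_two, eq_comm]
  refine ⟨e 0, e 1, fun h => e.ne_zero 0 ?_, hspan⟩
  have hmem : (e 0 : V) ∈ P ⊓ sC σ P := by
    refine ⟨(e 0).2, fun v hv => ?_⟩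
    rw [hspan] at hv
    obtain ⟨s, t, rfl⟩ := Submodule.mem_span_pair.mp hv
    simp [halt, h]
  rw [hP] at hmem
  exact Subtype.ext ((Submodule.mem_bot ℝ).mp hmem)

/-- Enlarging a symplectic plane by a further vector does not change its measure: the sum is
spanned by the plane and a vector in its symplectic complement. -/
theorem measure_span_pair_eq_span_triple {V : Type*} [AddCommGroup V] [Module ℝ V]
    (σ : V →ₗ[ℝ] V →ₗ[ℝ] ℝ) (halt : ∀ v : V, σ v v = 0) (μ : Submodule ℝ V → ℝ)
    (hadd : ∀ A B : Submodule ℝ V, A ≤ sC σ B → μ (A ⊔ B) = μ A + μ B)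
    {x y : V} (z : V) (hxy : σ x y ≠ 0) :
    μ (Submodule.span ℝ {x, y}) = μ (Submodule.span ℝ {x, y, z}) := by
  have hneg : ∀ v w, σ v w = - σ w v := fun v w => by
    have h := halt (v + w)
    simp only [map_add, LinearMap.add_apply, halt] at h
    linarith
  set r : V := σ x y • z + σ z x • y + σ y z • x with hr
  have hrx : σ r x = 0 := by
    simp only [hr, map_add, map_smul, LinearMap.add_apply, LinearMap.smul_apply, smul_eq_mul, halt]
    rw [hneg y x]; ring
  have hry : σ r y = 0 := by
    simp only [hr, map_add, map_smul, LinearMap.add_apply, LinearMap.smul_apply, smul_eq_mul, halt]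
    rw [hneg z y]; ring
  have hline : μ (Submodule.span ℝ {r}) = 0 := by
    have h := hadd (Submodule.span ℝ {r}) (Submodule.span ℝ {r}) (by
      rw [Submodule.span_singleton_le_iff_mem]
      intro v hv
      obtain ⟨t, rfl⟩ := Submodule.mem_span_singleton.mp hv
      simp [halt])
    rw [sup_idem] at h
    linarith
  have hsum := hadd (Submodule.span ℝ {r}) (Submodule.span ℝ {x, y}) (by
    rw [Submodule.span_singleton_le_iff_mem]
    intro v hv
    obtain ⟨s, t, rfl⟩ := Submodule.mem_span_pair.mp hv
    simp [hrx, hry])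
  rw [hline, zero_add] at hsum
  rw [← hsum, ← Submodule.span_union]
  congr 1
  apply le_antisymm <;> rw [Submodule.span_le]
  · have hx : x ∈ Submodule.span ℝ {x, y, z} := Submodule.subset_span (by simp)
    have hy : y ∈ Submodule.span ℝ {x, y, z} := Submodule.subset_span (by simp)
    have hz : z ∈ Submodule.span ℝ {x, y, z} := Submodule.subset_span (by simp)
    rintro v (rfl | rfl | rfl)
    · exact add_mem (add_mem (Submodule.smul_mem _ _ hz) (Submodule.smul_mem _ _ hy))
        (Submodule.smul_mem _ _ hx)
    · exact hx
    · exact hy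
  · have hx : x ∈ Submodule.span ℝ ({r} ∪ {x, y}) := Submodule.subset_span (by simp)
    have hy : y ∈ Submodule.span ℝ ({r} ∪ {x, y}) := Submodule.subset_span (by simp)
    have hr' : r ∈ Submodule.span ℝ ({r} ∪ {x, y}) := Submodule.subset_span (by simp)
    have hz : z ∈ Submodule.span ℝ ({r} ∪ {x, y}) := by
      rw [← Submodule.smul_mem_iff _ hxy]
      have h : σ x y • z = r - σ z x • y - σ y z • x := by rw [hr]; abel
      rw [h]
      exact sub_mem (sub_mem hr' (Submodule.smul_mem _ _ hy)) (Submodule.smul_mem _ _ hx)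
    rintro v (h | h | h) <;> rw [h] <;> assumption

/-- Symplectic planes sharing a line have the same measure. -/
theorem measure_span_pair_eq_of_common_line {V : Type*} [AddCommGroup V] [Module ℝ V]
    (σ : V →ₗ[ℝ] V →ₗ[ℝ] ℝ) (halt : ∀ v : V, σ v v = 0) (μ : Submodule ℝ V → ℝ)
    (hadd : ∀ A B : Submodule ℝ V, A ≤ sC σ B → μ (A ⊔ B) = μ A + μ B)
    {x y z : V} (hxy : σ x y ≠ 0) (hxz : σ x z ≠ 0) :
    μ (Submodule.span ℝ {x, y}) = μ (Submodule.span ℝ {x, z}) := by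
  rw [measure_span_pair_eq_span_triple σ halt μ hadd z hxy,
    measure_span_pair_eq_span_triple σ halt μ hadd y hxz, Set.pair_comm y z]

/-- A finitely additive probability measure on the subspace lattice of a real symplectic
vector space takes the same value on all symplectic planes. -/
theorem stmt_18 {V : Type*} [AddCommGroup V] [Module ℝ V]
    (σ : V →ₗ[ℝ] V →ₗ[ℝ] ℝ)
    (halt : ∀ v : V, σ v v = 0)
    (hnd : ∀ v : V, (∀ w : V, σ v w = 0) → v = 0)
    (μ : Submodule ℝ V → ℝ)
    (hrange : ∀ A : Submodule ℝ V, 0 ≤ μ A ∧ μ A ≤ 1)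
    (h0 : μ ⊥ = 0) (h1 : μ ⊤ = 1)
    (hmono : ∀ A B : Submodule ℝ V, A ≤ B → μ A ≤ μ B)
    (hadd : ∀ A B : Submodule ℝ V, A ≤ sC σ B → μ (A ⊔ B) = μ A + μ B)
    (P Q : Submodule ℝ V)
    (hP2 : Module.finrank ℝ P = 2) (hPsymp : P ⊓ sC σ P = ⊥)
    (hQ2 : Module.finrank ℝ Q = 2) (hQsymp : Q ⊓ sC σ Q = ⊥) :
    μ P = μ Q := by
  obtain ⟨a, b, hab, rfl⟩ := exists_span_pair_of_symplectic_plane σ halt P hP2 hPsymp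
  obtain ⟨c, d, hcd, rfl⟩ := exists_span_pair_of_symplectic_plane σ halt Q hQ2 hQsymp
  have hswap : ∀ v w, σ v w ≠ 0 → σ w v ≠ 0 := fun v w hvw h => hvw <| by
    have h' := halt (v + w)
    simp only [map_add, LinearMap.add_apply, halt] at h'
    linarith
  obtain ⟨e, hae, hce⟩ : ∃ e, σ a e ≠ 0 ∧ σ c e ≠ 0 := by
    by_cases hcb : σ c b = 0
    · by_cases had : σ a d = 0
      · exact ⟨b + d, by simpa [had] using hab, by simpa [hcb] using hcd⟩
      · exact ⟨d, had, hcd⟩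
    · exact ⟨b, hab, hcb⟩
  rw [measure_span_pair_eq_of_common_line σ halt μ hadd hab hae,
    measure_span_pair_eq_of_common_line σ halt μ hadd hcd hce, Set.pair_comm a e,
    Set.pair_comm c e]
  exact measure_span_pair_eq_of_common_line σ halt μ hadd (hswap _ _ hae) (hswap _ _ hce)
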